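/- arXiv:2506.06229 — 4 statements merged into one kernel-verified Lean document; each statement's English description precedes it below -/
import Mathlib

section
/- Let q ≥ 1 be an integer and let C be the chain complex of abelian groups with C_k = ℤ⟨[k]⟩ for every k ≥ 0 and differential d_k given by multiplication by q when k is even (k ≥ 2) and by 0 when k is odd. Define a bilinear graded product ∧ on C by: [2i] ∧ [2k] = C(i+k, i)·[2(i+k)]; [2i] ∧ [2k+1] = C(i+k, i)·[2(i+k)+1]; [2i+1] ∧ [2k] = C(i+k, i)·[2(i+k)+1]; and [2i+1] ∧ [2k+1] = 0, where C(i+k, i) is the binomial coefficient. Then ∧ satisfies the Leibniz rule: for homogeneous x ∈ C_a and y ∈ C_b, d(x ∧ y) = d(x) ∧ y + (−1)^a · x ∧ d(y). -/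
/-- The chain complex `C_•(ℤ_q)` with `C_k = ℤ⟨[k]⟩`, encoded as finitely supported
functions `ℕ →₀ ℤ`: the basis element `[k]` is `Finsupp.single k 1`. -/
abbrev C8 : Type := ℕ →₀ ℤ

/-- The structure constant of the Pontryagin product:
`[a] ∧ [b] = wedgeCoeff a b • [a + b]`, where `wedgeCoeff a b` is the binomial coefficient
`C(a/2 + b/2, a/2)` except that it is `0` when `a` and `b` are both odd. Explicitly:
`[2i] ∧ [2k] = C(i+k, i)·[2(i+k)]`, `[2i] ∧ [2k+1] = C(i+k, i)·[2(i+k)+1]`,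
`[2i+1] ∧ [2k] = C(i+k, i)·[2(i+k)+1]` and `[2i+1] ∧ [2k+1] = 0`. -/
def wedgeCoeff (a b : ℕ) : ℤ :=
  if Odd a ∧ Odd b then 0 else (Nat.choose (a / 2 + b / 2) (a / 2) : ℤ)

/-- The bilinear Pontryagin product `∧` on `C_•(ℤ_q)`. -/
noncomputable def wedge (x y : C8) : C8 :=
  x.sum fun a m => y.sum fun b n => Finsupp.single (a + b) (m * n * wedgeCoeff a b)

/-- The differential of `C_•(ℤ_q)`: `d[k] = q·[k-1]` when `k` is even with `k ≥ 2`, and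
`d[k] = 0` when `k` is odd (and `d[0] = 0`, as there is no differential out of degree 0). -/
noncomputable def dC8 (q : ℕ) (x : C8) : C8 :=
  x.sum fun k c => Finsupp.single (k - 1) ((if Even k ∧ 2 ≤ k then (q : ℤ) else 0) * c)

theorem wedge_single (a b : ℕ) (x y : ℤ) :
    wedge (Finsupp.single a x) (Finsupp.single b y) =
      Finsupp.single (a + b) (x * y * wedgeCoeff a b) := by
  simp [wedge, Finsupp.sum_single_index]

theorem dC8_single (q k : ℕ) (c : ℤ) :
    dC8 q (Finsupp.single k c) =
      Finsupp.single (k - 1) ((if Even k ∧ 2 ≤ k then (q : ℤ) else 0) * c) := by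
  simp [dC8, Finsupp.sum_single_index]

theorem dC8_single_zero (q : ℕ) (c : ℤ) : dC8 q (Finsupp.single 0 c) = 0 := by
  simp [dC8_single]

theorem dC8_single_even_succ (q i : ℕ) (c : ℤ) :
    dC8 q (Finsupp.single (2 * (i + 1)) c) = Finsupp.single (2 * i + 1) (q * c) := by
  rw [dC8_single, if_pos ⟨even_two_mul _, by omega⟩]
  rfl

theorem dC8_single_odd (q i : ℕ) (c : ℤ) : dC8 q (Finsupp.single (2 * i + 1) c) = 0 := by
  simp [dC8_single]

theorem wedge_zero_left (y : C8) : wedge 0 y = 0 := by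
  simp [wedge]

theorem wedge_zero_right (x : C8) : wedge x 0 = 0 := by
  simp [wedge]

theorem wedgeCoeff_even_even (i k : ℕ) :
    wedgeCoeff (2 * i) (2 * k) = (i + k).choose i := by
  simp [wedgeCoeff]

theorem wedgeCoeff_even_odd (i k : ℕ) :
    wedgeCoeff (2 * i) (2 * k + 1) = (i + k).choose i := by
  simp [wedgeCoeff, show (2 * k + 1) / 2 = k by omega]

theorem wedgeCoeff_odd_even (i k : ℕ) :
    wedgeCoeff (2 * i + 1) (2 * k) = (i + k).choose i := by
  simp [wedgeCoeff, show (2 * i + 1) / 2 = i by omega]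

theorem wedgeCoeff_odd_odd (i k : ℕ) : wedgeCoeff (2 * i + 1) (2 * k + 1) = 0 := by
  simp [wedgeCoeff]

theorem dC8_wedge_even_even (q i k : ℕ) (x y : ℤ) :
    dC8 q (wedge (Finsupp.single (2 * i) x) (Finsupp.single (2 * k) y)) =
      wedge (dC8 q (Finsupp.single (2 * i) x)) (Finsupp.single (2 * k) y) +
        wedge (Finsupp.single (2 * i) x) (dC8 q (Finsupp.single (2 * k) y)) := by
  rw [wedge_single, wedgeCoeff_even_even, ← mul_add]
  rcases i with _ | i <;> rcases k with _ | k
  · simp only [add_zero, mul_zero, dC8_single_zero, wedge_zero_left, wedge_zero_right]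
  · rw [show 0 + (k + 1) = k + 1 by omega, dC8_single_even_succ, dC8_single_even_succ, mul_zero,
      dC8_single_zero, wedge_zero_left, zero_add, wedge_single]
    have h := wedgeCoeff_even_odd 0 k
    rw [mul_zero] at h
    rw [h, zero_add]
    congr 1
    simp only [Nat.choose_zero_right]
    ring
  · rw [add_zero, dC8_single_even_succ, dC8_single_even_succ, mul_zero,
      dC8_single_zero, wedge_zero_right, add_zero, wedge_single]
    have h := wedgeCoeff_odd_even i 0
    rw [mul_zero] at h
    rw [h, add_zero]
    congr 1
    simp only [Nat.choose_self, add_zero]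
    ring
  · rw [show i + 1 + (k + 1) = i + k + 1 + 1 by omega, dC8_single_even_succ,
      dC8_single_even_succ, dC8_single_even_succ, wedge_single, wedge_single,
      wedgeCoeff_odd_even, wedgeCoeff_even_odd,
      show 2 * i + 1 + 2 * (k + 1) = 2 * (i + k + 1) + 1 by ring,
      show 2 * (i + 1) + (2 * k + 1) = 2 * (i + k + 1) + 1 by ring, ← Finsupp.single_add,
      show i + (k + 1) = i + k + 1 by ring, show i + 1 + k = i + k + 1 by ring,
      Nat.choose_succ_succ (i + k + 1) i]
    congr 1
    push_cast
    ring

/-- The Pontryagin product satisfies the Leibniz rule: for homogeneous `x ∈ C_a` and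
`y ∈ C_b` (i.e. `x = x·[a]`, `y = y·[b]`), `d(x ∧ y) = d(x) ∧ y + (-1)^a · x ∧ d(y)`. -/
theorem stmt8 (q : ℕ) (hq : 1 ≤ q) (a b : ℕ) (x y : ℤ) :
    dC8 q (wedge (Finsupp.single a x) (Finsupp.single b y)) =
      wedge (dC8 q (Finsupp.single a x)) (Finsupp.single b y) +
        ((-1 : ℤ) ^ a) • wedge (Finsupp.single a x) (dC8 q (Finsupp.single b y)) := by
  rcases Nat.even_or_odd' a with ⟨i, rfl | rfl⟩ <;>
    rcases Nat.even_or_odd' b with ⟨k, rfl | rfl⟩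
  · rw [(even_two_mul i).neg_one_pow, one_smul, dC8_wedge_even_even]
  · rw [wedge_single, show 2 * i + (2 * k + 1) = 2 * (i + k) + 1 by ring, dC8_single_odd,
      dC8_single_odd, wedge_zero_right, smul_zero, add_zero]
    rcases i with _ | i
    · rw [mul_zero, dC8_single_zero, wedge_zero_left]
    · rw [dC8_single_even_succ, wedge_single, wedgeCoeff_odd_odd, mul_zero, Finsupp.single_zero]
  · rw [wedge_single, show 2 * i + 1 + 2 * k = 2 * (i + k) + 1 by ring, dC8_single_odd,
      dC8_single_odd, wedge_zero_left, zero_add]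
    rcases k with _ | k
    · rw [mul_zero, dC8_single_zero, wedge_zero_right, smul_zero]
    · rw [dC8_single_even_succ, wedge_single, wedgeCoeff_odd_odd, mul_zero, Finsupp.single_zero,
        smul_zero]
  · rw [wedge_single, wedgeCoeff_odd_odd, mul_zero, dC8_single_odd, dC8_single_odd,
      wedge_zero_left, wedge_zero_right, smul_zero, add_zero, Finsupp.single_zero]
    simp [dC8]
end

section
/- Let r ≥ 1 and set m = 2^r − 1. For all integers i, j with 0 ≤ j < i ≤ m, the binomial coefficient C(m − j + i, i) is even. -/
/-- If adding `a` and `b` carries out of the `r` lowest base-`p` digits, then `p` divides the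
binomial coefficient `(a + b).choose b`. -/
theorem Nat.Prime.dvd_choose_add_of_pow_le_add {p r a b : ℕ} (hp : p.Prime)
    (ha : a < p ^ r) (hb : b < p ^ r) (hab : p ^ r ≤ a + b) : p ∣ (a + b).choose b := by
  have hr : r ≠ 0 := by
    rintro rfl
    simp only [pow_zero] at ha hb hab
    lia
  refine Nat.dvd_of_factorization_pos (Nat.pos_iff_ne_zero.1 ?_)
  rw [Nat.factorization_choose' hp (b := Nat.log p (a + b) + r + 1) (by lia),
    Finset.card_pos]
  refine ⟨r, Finset.mem_filter.2 ⟨Finset.mem_Ico.2 (by lia), ?_⟩⟩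
  rwa [Nat.mod_eq_of_lt ha, Nat.mod_eq_of_lt hb, add_comm]

/-- For `r ≥ 1`, `m = 2^r - 1`, and integers `0 ≤ j < i ≤ m`, the binomial coefficient
`C(m - j + i, i)` ("`(m-j)+i` choose `i`") is even. -/
theorem stmt9 (r : ℕ) (hr : 1 ≤ r) (i j : ℕ) (hji : j < i) (him : i ≤ 2 ^ r - 1) :
    Even (Nat.choose ((2 ^ r - 1) - j + i) i) := by
  have hpos : 0 < 2 ^ r := by positivity
  exact even_iff_two_dvd.2 (Nat.prime_two.dvd_choose_add_of_pow_le_add (r := r) (by lia) (by lia) (by lia))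
end

section
/- Let r ≥ 1, set m = 2^r − 1, and let s = 2σ be an even integer with 4 ≤ s ≤ 2^{r+1} − 2. Let δ_1, …, δ_{s−2} ∈ {0, 1} and let p_1, …, p_{s−2}, q_1, …, q_{s−2} be natural numbers satisfying: (i) p_i + q_i = m − δ_i for every 1 ≤ i ≤ s−2; (ii) δ_1 = 0; and (iii) for every 1 ≤ i < s−2, if δ_i = 1 then δ_{i+1} = 0. Then the product of binomial coefficients C(m + p_1, p_1) · C(q_1 + p_2, p_2) · C(q_2 + p_3, p_3) ⋯ C(q_{s−3} + p_{s−2}, p_{s−2}) · C(q_{s−2} + m, m) is even. -/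
/-- A carry out of the top binary digit makes a binomial coefficient even. -/
theorem Nat.even_choose_add_of_two_pow_le {r a b : ℕ} (ha : a < 2 ^ r) (hb : b < 2 ^ r)
    (h : 2 ^ r ≤ a + b) : Even (Nat.choose (a + b) b) := by
  have hr : 1 ≤ r := by
    rcases r with _ | r
    · simp at ha hb h
      omega
    · omega
  have hlog : Nat.log 2 (a + b) < r + 1 := by
    apply Nat.log_lt_of_lt_pow
    · have := Nat.two_pow_pos r
      omega
    · rw [pow_succ]
      omega
  rw [even_iff_two_dvd]
  apply dvd_of_one_le_padicValNat
  rw [padicValNat_choose' hlog, Nat.succ_le_iff, Finset.card_pos]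
  refine ⟨r, ?_⟩
  rw [Finset.mem_filter, Finset.mem_Ico, Nat.mod_eq_of_lt ha, Nat.mod_eq_of_lt hb]
  omega

/-- Let `r ≥ 1`, `m = 2^r - 1`, and let `s = 2σ` be even with `4 ≤ s ≤ 2^{r+1} - 2`.
Given `δ_1, ..., δ_{s-2} ∈ {0,1}` and naturals `p_i, q_i` with `p_i + q_i = m - δ_i` for
`1 ≤ i ≤ s-2`, with `δ_1 = 0` and no two consecutive `δ`'s equal to `1`, the product
`C(m + p_1, p_1) · C(q_1 + p_2, p_2) ⋯ C(q_{s-3} + p_{s-2}, p_{s-2}) · C(q_{s-2} + m, m)`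
of binomial coefficients is even. -/
theorem stmt10 (r : ℕ) (hr : 1 ≤ r) (s : ℕ) (hs4 : 4 ≤ s) (hse : Even s)
    (hsn : s ≤ 2 ^ (r + 1) - 2) (δ p q : ℕ → ℕ)
    (hδ01 : ∀ i, 1 ≤ i → i ≤ s - 2 → δ i = 0 ∨ δ i = 1)
    (hpq : ∀ i, 1 ≤ i → i ≤ s - 2 → p i + q i = (2 ^ r - 1) - δ i)
    (hδ1 : δ 1 = 0)
    (hcons : ∀ i, 1 ≤ i → i < s - 2 → δ i = 1 → δ (i + 1) = 0) :
    Even (Nat.choose ((2 ^ r - 1) + p 1) (p 1) *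
      (∏ i ∈ Finset.Icc 1 (s - 3), Nat.choose (q i + p (i + 1)) (p (i + 1))) *
      Nat.choose (q (s - 2) + (2 ^ r - 1)) (2 ^ r - 1)) := by
  by_contra hodd
  simp only [Nat.not_even_iff_odd, Nat.odd_mul] at hodd
  obtain ⟨⟨hfirst, hmid⟩, hlast⟩ := hodd
  have hpow : 2 ≤ 2 ^ r := by
    simpa using Nat.pow_le_pow_right (n := 2) (by norm_num) hr
  rw [pow_succ] at hsn
  have no_carry : ∀ a b, a < 2 ^ r → b < 2 ^ r → Odd (Nat.choose (a + b) b) → a + b < 2 ^ r := by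
    intro a b ha hb h
    by_contra! hab
    exact Nat.not_even_iff_odd.mpr h (Nat.even_choose_add_of_two_pow_le ha hb hab)
  have hq : ∀ i, 1 ≤ i → i ≤ s - 2 → 2 * (2 ^ r - 1) + 1 ≤ 2 * q i + i + δ i := by
    intro i hi
    induction i, hi using Nat.le_induction with
    | base =>
      intro h
      have h1 := hpq 1 le_rfl h
      have := no_carry _ _ (by omega) (by omega) hfirst
      omega
    | succ i hi ih =>
      intro h
      have ih := ih (by omega)
      have h1 := hpq i hi (by omega)
      have h2 := hpq (i + 1) (by omega) h
      have hmem : i ∈ Finset.Icc 1 (s - 3) := Finset.mem_Icc.mpr ⟨hi, by omega⟩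
      have := no_carry (q i) (p (i + 1)) (by omega) (by omega)
        (hmid.of_dvd_nat (Finset.dvd_prod_of_mem _ hmem))
      have := hcons i hi (by omega)
      have := hδ01 i hi (by omega)
      have := hδ01 (i + 1) (by omega) h
      omega
  have h1 := hq (s - 2) (by omega) le_rfl
  have h2 := hpq (s - 2) (by omega) le_rfl
  have h3 := hδ01 (s - 2) (by omega) le_rfl
  have h4 := no_carry _ _ (by omega) (by omega) hlast
  obtain ⟨k, rfl⟩ := hse
  omega
end

section
/- Fix an integer σ ≥ 1 and let D be the free abelian group with basis {[w] : w ∈ ℕ^{2σ−1}}, with the ℤ-linear map ∂ : D → D given on basis elements by ∂[w] = Σ_{t=1}^{2σ−1} c_t(w)·[w − e_t], where e_t is the t-th standard basis vector, [w − e_t] is interpreted as 0 when w_t = 0, and c_t(w) = −2·(−1)^{w_1 + ⋯ + w_{t−1}} if t is odd and w_t is odd, c_t(w) = 2·(−1)^{w_1 + ⋯ + w_{t−1}} if t is even and w_t is even, and c_t(w) = 0 otherwise. Call a basis element [w] odd if its first coordinate w_1 is odd. Then in the quotient group D / ∂(D), the images of the odd basis elements generate a torsion-free subgroup. -/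
/-- The sign `(-1)^{w_1 + ⋯ + w_{t-1}}` appearing in the differential of the complex `𝒟_•`. -/
def dSign (n : ℕ) (w : Fin n → ℕ) (t : Fin n) : ℤ :=
  (-1) ^ (∑ j ∈ Finset.univ.filter (fun j : Fin n => j < t), w j)

/-- The coefficient `c_t(w)`: with 1-indexed coordinates (so the `t`-th coordinate,
`1 ≤ t ≤ n`, corresponds to the index `t - 1 : Fin n`), it is
`-2·(-1)^{w_1+⋯+w_{t-1}}` if `t` is odd and `w_t` is odd,
`2·(-1)^{w_1+⋯+w_{t-1}}` if `t` is even and `w_t` is even, and `0` otherwise. -/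
def dCoeff (n : ℕ) (w : Fin n → ℕ) (t : Fin n) : ℤ :=
  if t.1 % 2 = 0 then (if Odd (w t) then -2 * dSign n w t else 0)
  else (if Even (w t) then 2 * dSign n w t else 0)

/-- The summand `c_t(w)·[w - e_t]` of `∂[w]`, interpreted as `0` when `w_t = 0`. -/
noncomputable def dTerm (n : ℕ) (w : Fin n → ℕ) (t : Fin n) : (Fin n → ℕ) →₀ ℤ :=
  if w t = 0 then 0
  else Finsupp.single (Function.update w t (w t - 1)) (dCoeff n w t)

/-- The differential `∂` of the free abelian group `D` with basis `{[w] : w ∈ ℕ^n}`: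
`∂[w] = Σ_t c_t(w)·[w - e_t]`, extended `ℤ`-linearly. -/
noncomputable def bd (n : ℕ) : ((Fin n → ℕ) →₀ ℤ) →ₗ[ℤ] ((Fin n → ℕ) →₀ ℤ) :=
  Finsupp.lsum ℤ fun w => LinearMap.toSpanSingleton ℤ _ (∑ t, dTerm n w t)

/-- The `t`-th partial differential, sending `[w]` to the summand `c_t(w)·[w - e_t]` of `∂[w]`. -/
noncomputable def bdPart (n : ℕ) (t : Fin n) : ((Fin n → ℕ) →₀ ℤ) →ₗ[ℤ] ((Fin n → ℕ) →₀ ℤ) :=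
  Finsupp.lsum ℤ fun w => LinearMap.toSpanSingleton ℤ _ (dTerm n w t)

lemma bdPart_single (n : ℕ) (t : Fin n) (w : Fin n → ℕ) (a : ℤ) :
    bdPart n t (Finsupp.single w a) = a • dTerm n w t := by
  simp [bdPart]

lemma bd_single (n : ℕ) (w : Fin n → ℕ) (a : ℤ) :
    bd n (Finsupp.single w a) = a • ∑ t, dTerm n w t := by
  simp [bd]

lemma bd_eq_sum (n : ℕ) : bd n = ∑ t, bdPart n t := by
  refine Finsupp.lhom_ext fun w a => ?_
  rw [bd_single, LinearMap.sum_apply, Finset.smul_sum]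
  simp only [bdPart_single]

lemma dSign_update_of_le (n : ℕ) (w : Fin n → ℕ) {s t : Fin n} (h : t ≤ s) (k : ℕ) :
    dSign n (Function.update w s k) t = dSign n w t := by
  unfold dSign
  congr 1
  refine Finset.sum_congr rfl fun j hj => ?_
  have hj' : j < t := by simpa using hj
  rw [Function.update_of_ne (hj'.trans_le h).ne]

lemma dSign_update_of_lt (n : ℕ) (w : Fin n → ℕ) {s t : Fin n} (h : s < t) (hw : w s ≠ 0) :
    dSign n (Function.update w s (w s - 1)) t = -dSign n w t := by
  unfold dSign
  have hs : s ∈ Finset.univ.filter (fun j : Fin n => j < t) := by simpa using h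
  rw [Finset.sum_update_of_mem hs, ← Finset.add_sum_erase _ w hs, Finset.sdiff_singleton_eq_erase]
  obtain ⟨k, hk⟩ := Nat.exists_eq_succ_of_ne_zero hw
  rw [hk, Nat.succ_sub_one, Nat.succ_eq_add_one, pow_add, pow_add, pow_succ]
  ring

/-- The coefficient `c_t(w)` factors as a number depending only on `t` and `w t`, times the sign. -/
lemma dCoeff_eq (n : ℕ) (w : Fin n → ℕ) (t : Fin n) :
    dCoeff n w t = (if t.1 % 2 = 0 then (if Odd (w t) then -2 else 0)
      else (if Even (w t) then 2 else 0)) * dSign n w t := by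
  unfold dCoeff
  split_ifs <;> simp

lemma bdPart_dTerm_of_lt (n : ℕ) (w : Fin n → ℕ) {s t : Fin n} (h : s < t) :
    bdPart n s (dTerm n w t) = -bdPart n t (dTerm n w s) := by
  unfold dTerm
  by_cases hs : w s = 0
  · by_cases ht : w t = 0
    · simp [hs, ht]
    · simp [hs, ht, bdPart_single, dTerm, Function.update_of_ne h.ne]
  · by_cases ht : w t = 0
    · simp [hs, ht, bdPart_single, dTerm, Function.update_of_ne h.ne']
    · simp only [hs, ht, if_false, bdPart_single, dTerm, Function.update_of_ne h.ne,
        Function.update_of_ne h.ne', Finsupp.smul_single, smul_eq_mul, dCoeff_eq,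
        dSign_update_of_le n w h.le, dSign_update_of_lt n w h hs,
        Function.update_comm h.ne, ← Finsupp.single_neg]
      congr 1
      ring

lemma bdPart_dTerm_self (n : ℕ) (w : Fin n → ℕ) (t : Fin n) :
    bdPart n t (dTerm n w t) = 0 := by
  unfold dTerm
  by_cases ht : w t = 0
  · simp [ht]
  · obtain ⟨k, hk⟩ := Nat.exists_eq_succ_of_ne_zero ht
    rw [if_neg ht, bdPart_single, dTerm]
    simp only [dCoeff_eq, Function.update_self, hk, Nat.succ_eq_add_one, Nat.add_sub_cancel,
      Nat.odd_add_one, Nat.even_add_one, ← Nat.not_even_iff_odd]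
    split_ifs <;> simp_all

lemma bdPart_comp (n : ℕ) (s t : Fin n) (x : (Fin n → ℕ) →₀ ℤ) :
    bdPart n s (bdPart n t x) = -bdPart n t (bdPart n s x) := by
  induction x using Finsupp.induction_linear with
  | zero => simp
  | add f g hf hg => simp only [map_add, hf, hg, neg_add]
  | single w a =>
    simp only [bdPart_single, map_smul, ← smul_neg]
    congr 1
    rcases lt_trichotomy s t with h | rfl | h
    · exact bdPart_dTerm_of_lt n w h
    · simp [bdPart_dTerm_self]
    · rw [bdPart_dTerm_of_lt n w h, neg_neg]

lemma bd_bd (n : ℕ) (x : (Fin n → ℕ) →₀ ℤ) : bd n (bd n x) = 0 := by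
  have key : bd n (bd n x) = -bd n (bd n x) := by
    simp only [bd_eq_sum, LinearMap.sum_apply, map_sum]
    conv_rhs => rw [Finset.sum_comm]
    rw [← Finset.sum_neg_distrib]
    refine Finset.sum_congr rfl fun s _ => ?_
    rw [← Finset.sum_neg_distrib]
    exact Finset.sum_congr rfl fun t _ => bdPart_comp n _ _ x
  exact self_eq_neg.mp key

/-- Among the words with odd first coordinate, only `w` has `w - e_1` in its boundary. -/
lemma sum_dTerm_apply_of_odd (n : ℕ) (hn : 0 < n) (u w : Fin n → ℕ)
    (hu : Odd (u ⟨0, hn⟩)) (hw : Odd (w ⟨0, hn⟩)) :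
    (∑ t, dTerm n u t) (Function.update w ⟨0, hn⟩ (w ⟨0, hn⟩ - 1)) = if u = w then -2 else 0 := by
  set o : Fin n := ⟨0, hn⟩ with ho
  have hu0 : u o ≠ 0 := hu.pos.ne'
  have hw0 : w o ≠ 0 := hw.pos.ne'
  have hsign : dSign n u o = 1 := by simp [dSign, ho, Fin.lt_def]
  rw [Finsupp.finsetSum_apply, Finset.sum_eq_single o]
  · have hc : dCoeff n u o = -2 := by
      rw [dCoeff_eq, hsign, if_pos (show o.1 % 2 = 0 from rfl), if_pos hu, mul_one]
    have hiff : Function.update u o (u o - 1) = Function.update w o (w o - 1) ↔ u = w := by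
      refine ⟨fun h => ?_, fun h => by rw [h]⟩
      funext j
      have hj := congrFun h j
      by_cases hjo : j = o
      · subst hjo
        simp only [Function.update_self] at hj
        omega
      · simpa [Function.update_of_ne hjo] using hj
    simp only [dTerm, hu0, if_false, Finsupp.single_apply, hiff, hc]
  · intro t _ ht
    unfold dTerm
    split_ifs with h
    · rfl
    · refine Finsupp.single_eq_of_ne fun heq => ?_
      have h0 := congrFun heq o
      simp only [Function.update_self, Function.update_of_ne ht.symm] at h0
      obtain ⟨a, ha⟩ := hu
      obtain ⟨b, hb⟩ := hw
      omega
  · simp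

lemma bd_apply (n : ℕ) (y : (Fin n → ℕ) →₀ ℤ) (v : Fin n → ℕ) :
    bd n y v = ∑ u ∈ y.support, y u * (∑ t, dTerm n u t) v := by
  simp only [bd, Finsupp.lsum_apply, Finsupp.sum, LinearMap.toSpanSingleton_apply]
  rw [Finsupp.finsetSum_apply]
  rfl

/-- `∂` is injective on the span of the odd basis elements. -/
lemma eq_zero_of_bd_eq_zero (n : ℕ) (hn : 0 < n) (y : (Fin n → ℕ) →₀ ℤ)
    (hy : y ∈ Finsupp.supported ℤ ℤ {w : Fin n → ℕ | Odd (w ⟨0, hn⟩)}) (h : bd n y = 0) :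
    y = 0 := by
  rw [Finsupp.mem_supported] at hy
  ext w
  by_contra hw
  have hwm : w ∈ y.support := Finsupp.mem_support_iff.mpr hw
  have hv := DFunLike.congr_fun h (Function.update w ⟨0, hn⟩ (w ⟨0, hn⟩ - 1))
  rw [bd_apply, Finset.sum_congr rfl fun u hu => by
    rw [sum_dTerm_apply_of_odd n hn u w (hy hu) (hy hwm)]] at hv
  simp only [mul_ite, mul_zero, Finset.sum_ite_eq', hwm, if_true, Finsupp.coe_zero,
    Pi.zero_apply] at hv
  exact hw (by simpa using hv)

/-- In the quotient `D / ∂(D)` of the free abelian group `D` on `ℕ^{2σ-1}` by the image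
of the differential `∂`, the images of the odd basis elements (those `[w]` with `w_1` odd)
generate a torsion-free subgroup. -/
theorem stmt12 (σ : ℕ) (hσ : 1 ≤ σ)
    (x : ((Fin (2 * σ - 1) → ℕ) →₀ ℤ) ⧸ LinearMap.range (bd (2 * σ - 1)))
    (hx : x ∈ Submodule.span ℤ
      {y | ∃ w : Fin (2 * σ - 1) → ℕ, Odd (w ⟨0, by omega⟩) ∧
        y = Submodule.Quotient.mk (Finsupp.single w (1 : ℤ))})
    (c : ℤ) (hc : c • x = 0) : c = 0 ∨ x = 0 := by
  have hn : 0 < 2 * σ - 1 := by omega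
  have hlift : x ∈ (Finsupp.supported ℤ ℤ {w : Fin (2 * σ - 1) → ℕ | Odd (w ⟨0, hn⟩)}).map
      (LinearMap.range (bd (2 * σ - 1))).mkQ := by
    refine Submodule.span_le.mpr ?_ hx
    rintro _ ⟨w, hw, rfl⟩
    exact ⟨_, Finsupp.single_mem_supported ℤ 1 hw, rfl⟩
  obtain ⟨y, hy, rfl⟩ := hlift
  rw [or_iff_not_imp_left]
  intro hc0
  rw [← map_smul, Submodule.mkQ_apply, Submodule.Quotient.mk_eq_zero] at hc
  obtain ⟨z, hz⟩ := hc
  have hcy : c • bd (2 * σ - 1) y = 0 := by rw [← map_smul, ← hz, bd_bd]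
  rw [eq_zero_of_bd_eq_zero _ hn y hy ((smul_eq_zero.mp hcy).resolve_left hc0), map_zero]
end
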